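/- Assume conditions (C1)–(C6) hold and that ‖f_j∘ψ_j‖ > 0 and ‖f₁‖_j > 0 for 2 ≤ j ≤ k. Then for every λ₀ ≥ 0, Σ_{j=2}^k ρ(f₁*, f_j | ψ_j) ≥ Σ_{j=2}^k ρ(f₁, f_j | ψ_j). -/

import Mathlib

noncomputable section

/-- `Ef = ∫₀¹ f(x) dx`. -/
def Emean (f : ℝ → ℝ) : ℝ := ∫ x in (0:ℝ)..1, f x

/-- The centered inner product `⟨f, g⟩ = ∫₀¹ (f(x) − Ef)(g(x) − Eg) dx`. -/
def cinner (f g : ℝ → ℝ) : ℝ := ∫ x in (0:ℝ)..1, (f x - Emean f) * (g x - Emean g)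

/-- The semi-norm `‖f‖ = √⟨f, f⟩`. -/
def cnorm (f : ℝ → ℝ) : ℝ := Real.sqrt (cinner f f)

/-- The similarity `r(f, g) = ⟨f, g⟩ / (‖f‖ ‖g‖)`. -/
def csim (f g : ℝ → ℝ) : ℝ := cinner f g / (cnorm f * cnorm g)

/-- The space `𝓜` of warping functions: continuously differentiable strictly increasing
functions `ψ : [0,1] → [0,1]` with `ψ(0) = 0`, `ψ(1) = 1` whose inverse is also
continuously differentiable.  The inverse is carried explicitly. -/
structure Warp where
  toFun : ℝ → ℝ
  invFun : ℝ → ℝ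
  maps_to : ∀ t ∈ Set.Icc (0:ℝ) 1, toFun t ∈ Set.Icc (0:ℝ) 1
  strictMono : StrictMonoOn toFun (Set.Icc (0:ℝ) 1)
  diff : ∀ t ∈ Set.Icc (0:ℝ) 1, DifferentiableAt ℝ toFun t
  deriv_cont : ContinuousOn (deriv toFun) (Set.Icc (0:ℝ) 1)
  map_zero : toFun 0 = 0
  map_one : toFun 1 = 1
  inv_maps_to : ∀ t ∈ Set.Icc (0:ℝ) 1, invFun t ∈ Set.Icc (0:ℝ) 1
  left_inv : ∀ t ∈ Set.Icc (0:ℝ) 1, invFun (toFun t) = t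
  right_inv : ∀ t ∈ Set.Icc (0:ℝ) 1, toFun (invFun t) = t
  inv_diff : ∀ t ∈ Set.Icc (0:ℝ) 1, DifferentiableAt ℝ invFun t
  inv_deriv_cont : ContinuousOn (deriv invFun) (Set.Icc (0:ℝ) 1)

/-- `E_ψ f = ∫₀¹ f(t) ψ′(t) dt`. -/
def wE (ψ : ℝ → ℝ) (f : ℝ → ℝ) : ℝ := ∫ t in (0:ℝ)..1, f t * deriv ψ t

/-- `⟨f, g⟩_ψ = ∫₀¹ (f(t) − E_ψ f)(g(t) − E_ψ g) ψ′(t) dt`. -/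
def winner (ψ : ℝ → ℝ) (f g : ℝ → ℝ) : ℝ :=
  ∫ t in (0:ℝ)..1, (f t - wE ψ f) * (g t - wE ψ g) * deriv ψ t

/-- `‖f‖_ψ = √⟨f, f⟩_ψ`. -/
def wnorm (ψ : ℝ → ℝ) (f : ℝ → ℝ) : ℝ := Real.sqrt (winner ψ f f)

/-- `ρ*(f, g | ψ) = r(f, g∘ψ) − l₀ ∫₀¹ (ψ′(t) − 1)² dt`. -/
def rhoStar (l₀ : ℝ) (f g : ℝ → ℝ) (ψ : ℝ → ℝ) : ℝ :=
  csim f (g ∘ ψ) - l₀ * ∫ t in (0:ℝ)..1, (deriv ψ t - 1) ^ 2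

/-- `ρ(f, g | ψ) = (ρ*(f, g | ψ) + ρ*(g, f | ψ⁻¹))/2`. -/
def rhoW (l₀ : ℝ) (f g : ℝ → ℝ) (w : Warp) : ℝ :=
  (rhoStar l₀ f g w.toFun + rhoStar l₀ g f w.invFun) / 2

/-- The similarity measure `ρ(f, g) = sup_{ψ ∈ 𝓜} ρ(f, g | ψ)`. -/
def rhoSim (l₀ : ℝ) (f g : ℝ → ℝ) : ℝ := ⨆ w : Warp, rhoW l₀ f g w


lemma cinner_comm (f g : ℝ → ℝ) : cinner f g = cinner g f := by
  simp only [cinner, mul_comm]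

lemma cinner_self_nonneg (f : ℝ → ℝ) : 0 ≤ cinner f f :=
  intervalIntegral.integral_nonneg zero_le_one fun _ _ => mul_self_nonneg _

lemma cnorm_nonneg (f : ℝ → ℝ) : 0 ≤ cnorm f := Real.sqrt_nonneg _

lemma cnorm_sq (f : ℝ → ℝ) : cnorm f ^ 2 = cinner f f := Real.sq_sqrt (cinner_self_nonneg f)

lemma csim_comm (f g : ℝ → ℝ) : csim f g = csim g f := by
  rw [csim, csim, cinner_comm, mul_comm (cnorm f)]

lemma Emean_congr {f g : ℝ → ℝ} (h : Set.EqOn f g (Set.Icc 0 1)) : Emean f = Emean g := by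
  refine intervalIntegral.integral_congr ?_
  rwa [Set.uIcc_of_le zero_le_one]

lemma cinner_congr {f f' g g' : ℝ → ℝ} (hf : Set.EqOn f f' (Set.Icc 0 1))
    (hg : Set.EqOn g g' (Set.Icc 0 1)) : cinner f g = cinner f' g' := by
  rw [cinner, cinner, Emean_congr hf, Emean_congr hg]
  refine intervalIntegral.integral_congr fun t ht => ?_
  rw [Set.uIcc_of_le zero_le_one] at ht
  simp only [hf ht, hg ht]

lemma intervalIntegrable_unit {f : ℝ → ℝ} (hf : ContinuousOn f (Set.Icc 0 1)) :
    IntervalIntegrable f MeasureTheory.volume 0 1 :=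
  hf.intervalIntegrable_of_Icc zero_le_one

lemma Emean_lincomb {f g : ℝ → ℝ} (hf : ContinuousOn f (Set.Icc 0 1))
    (hg : ContinuousOn g (Set.Icc 0 1)) (a b : ℝ) :
    Emean (fun t => a * f t + b * g t) = a * Emean f + b * Emean g := by
  rw [Emean, intervalIntegral.integral_add ((intervalIntegrable_unit hf).const_mul a)
    ((intervalIntegrable_unit hg).const_mul b), intervalIntegral.integral_const_mul,
    intervalIntegral.integral_const_mul, Emean, Emean]

lemma cinner_lincomb_left {f g h : ℝ → ℝ} (hf : ContinuousOn f (Set.Icc 0 1))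
    (hg : ContinuousOn g (Set.Icc 0 1)) (hh : ContinuousOn h (Set.Icc 0 1)) (a b : ℝ) :
    cinner (fun t => a * f t + b * g t) h = a * cinner f h + b * cinner g h := by
  have centered_mul : ∀ {u : ℝ → ℝ}, ContinuousOn u (Set.Icc 0 1) →
      IntervalIntegrable (fun x => (u x - Emean u) * (h x - Emean h))
        MeasureTheory.volume 0 1 := fun hu =>
    intervalIntegrable_unit ((hu.sub continuousOn_const).mul (hh.sub continuousOn_const))
  rw [cinner, cinner, cinner, Emean_lincomb hf hg, ← intervalIntegral.integral_const_mul,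
    ← intervalIntegral.integral_const_mul,
    ← intervalIntegral.integral_add ((centered_mul hf).const_mul a)
      ((centered_mul hg).const_mul b)]
  congr 1
  ext x
  ring

lemma cinner_lincomb_right {f g h : ℝ → ℝ} (hf : ContinuousOn f (Set.Icc 0 1))
    (hg : ContinuousOn g (Set.Icc 0 1)) (hh : ContinuousOn h (Set.Icc 0 1)) (a b : ℝ) :
    cinner h (fun t => a * f t + b * g t) = a * cinner h f + b * cinner h g := by
  rw [cinner_comm, cinner_lincomb_left hf hg hh, cinner_comm f, cinner_comm g]

lemma continuousOn_lincomb {f g : ℝ → ℝ} (hf : ContinuousOn f (Set.Icc 0 1))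
    (hg : ContinuousOn g (Set.Icc 0 1)) (a b : ℝ) :
    ContinuousOn (fun t => a * f t + b * g t) (Set.Icc 0 1) :=
  (continuousOn_const.mul hf).add (continuousOn_const.mul hg)

lemma cinner_lincomb_self {f g : ℝ → ℝ} (hf : ContinuousOn f (Set.Icc 0 1))
    (hg : ContinuousOn g (Set.Icc 0 1)) (a b : ℝ) :
    cinner (fun t => a * f t + b * g t) (fun t => a * f t + b * g t) =
      a ^ 2 * cinner f f + 2 * (a * b) * cinner f g + b ^ 2 * cinner g g := by
  rw [cinner_lincomb_left hf hg (continuousOn_lincomb hf hg a b), cinner_lincomb_right hf hg hf,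
    cinner_lincomb_right hf hg hg, cinner_comm g f]
  ring

lemma continuousOn_sum_mul {ι : Type*} {I : Finset ι} {φ : ι → ℝ → ℝ}
    (hφ : ∀ j ∈ I, ContinuousOn (φ j) (Set.Icc 0 1)) (c : ι → ℝ) :
    ContinuousOn (fun t => ∑ j ∈ I, c j * φ j t) (Set.Icc 0 1) :=
  continuousOn_finsetSum I fun j hj => continuousOn_const.mul (hφ j hj)

lemma cinner_sum_left {ι : Type*} {I : Finset ι} {φ : ι → ℝ → ℝ} {h : ℝ → ℝ}
    (hφ : ∀ j ∈ I, ContinuousOn (φ j) (Set.Icc 0 1)) (hh : ContinuousOn h (Set.Icc 0 1))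
    (c : ι → ℝ) :
    cinner (fun t => ∑ j ∈ I, c j * φ j t) h = ∑ j ∈ I, c j * cinner (φ j) h := by
  classical
  induction I using Finset.induction_on with
  | empty => simp [cinner, Emean]
  | insert i I hi ih =>
    have hI : ∀ j ∈ I, ContinuousOn (φ j) (Set.Icc 0 1) := fun j hj =>
      hφ j (Finset.mem_insert_of_mem hj)
    have key := cinner_lincomb_left (hφ i (Finset.mem_insert_self i I))
      (continuousOn_sum_mul hI c) hh (c i) 1
    simp only [one_mul] at key
    simp only [Finset.sum_insert hi]
    rw [key, ih hI]

lemma abs_cinner_le {f g : ℝ → ℝ} (hf : ContinuousOn f (Set.Icc 0 1))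
    (hg : ContinuousOn g (Set.Icc 0 1)) : |cinner f g| ≤ cnorm f * cnorm g := by
  refine abs_le_of_sq_le_sq ?_ (mul_nonneg (cnorm_nonneg f) (cnorm_nonneg g))
  rw [mul_pow, cnorm_sq, cnorm_sq]
  have quad : ∀ x : ℝ,
      0 ≤ cinner f f * (x * x) + 2 * cinner f g * x + cinner g g := fun x => by
    have h := cinner_self_nonneg fun t => x * f t + 1 * g t
    rw [cinner_lincomb_self hf hg] at h
    linarith
  have h := discrim_le_zero quad
  rw [discrim] at h
  linarith

lemma csim_const_mul_right {h : ℝ → ℝ} (f : ℝ → ℝ) {c : ℝ} (hc : 0 < c) :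
    csim f (fun t => c * h t) = csim f h := by
  have hE : Emean (fun t => c * h t) = c * Emean h := intervalIntegral.integral_const_mul _ _
  have hl : ∀ u : ℝ → ℝ, cinner u (fun t => c * h t) = c * cinner u h := fun u => by
    rw [cinner, cinner, hE, ← intervalIntegral.integral_const_mul]
    congr 1
    ext x
    ring
  have hn : cnorm (fun t => c * h t) = c * cnorm h := by
    rw [cnorm, hl, cinner_comm, hl, ← mul_assoc, Real.sqrt_mul (mul_self_nonneg c),
      Real.sqrt_mul_self hc.le, cnorm]
  rw [csim, csim, hl, hn, mul_left_comm, mul_div_mul_left _ _ hc.ne']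

namespace Warp

variable (w : Warp)

lemma continuousOn_toFun : ContinuousOn w.toFun (Set.Icc 0 1) := fun t ht =>
  (w.diff t ht).continuousAt.continuousWithinAt

lemma continuousOn_invFun : ContinuousOn w.invFun (Set.Icc 0 1) := fun t ht =>
  (w.inv_diff t ht).continuousAt.continuousWithinAt

lemma continuousOn_comp {f : ℝ → ℝ} (hf : ContinuousOn f (Set.Icc 0 1)) :
    ContinuousOn (f ∘ w.toFun) (Set.Icc 0 1) :=
  hf.comp w.continuousOn_toFun w.maps_to

lemma continuousOn_comp_inv {f : ℝ → ℝ} (hf : ContinuousOn f (Set.Icc 0 1)) :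
    ContinuousOn (f ∘ w.invFun) (Set.Icc 0 1) :=
  hf.comp w.continuousOn_invFun w.inv_maps_to

lemma eqOn_comp_comp_inv (f : ℝ → ℝ) :
    Set.EqOn ((f ∘ w.toFun) ∘ w.invFun) f (Set.Icc 0 1) := fun t ht =>
  congrArg f (w.right_inv t ht)

lemma integral_mul_deriv {f : ℝ → ℝ} (hf : ContinuousOn f (Set.Icc 0 1)) :
    ∫ t in (0:ℝ)..1, f t * deriv w.toFun t = ∫ x in (0:ℝ)..1, f (w.invFun x) := by
  have key := intervalIntegral.integral_comp_mul_deriv'' (a := 0) (b := 1) (f := w.toFun)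
    (f' := deriv w.toFun) (g := f ∘ w.invFun)
    (by rw [Set.uIcc_of_le zero_le_one]; exact w.continuousOn_toFun)
    (fun t ht => by
      rw [min_eq_left zero_le_one, max_eq_right zero_le_one] at ht
      exact (w.diff t (Set.Ioo_subset_Icc_self ht)).hasDerivAt.hasDerivWithinAt)
    (by rw [Set.uIcc_of_le zero_le_one]; exact w.deriv_cont)
    (by
      rw [Set.uIcc_of_le zero_le_one]
      exact (w.continuousOn_comp_inv hf).mono (Set.image_subset_iff.mpr w.maps_to))
  rw [w.map_zero, w.map_one] at key
  refine Eq.trans (intervalIntegral.integral_congr fun t ht => ?_) key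
  rw [Set.uIcc_of_le zero_le_one] at ht
  simp only [Function.comp_apply, w.left_inv t ht]

lemma winner_eq {f g : ℝ → ℝ} (hf : ContinuousOn f (Set.Icc 0 1))
    (hg : ContinuousOn g (Set.Icc 0 1)) :
    winner w.toFun f g = cinner (f ∘ w.invFun) (g ∘ w.invFun) := by
  have hE : ∀ {u : ℝ → ℝ}, ContinuousOn u (Set.Icc 0 1) →
      wE w.toFun u = Emean (u ∘ w.invFun) := fun hu => w.integral_mul_deriv hu
  rw [winner, hE hf, hE hg]
  exact w.integral_mul_deriv ((hf.sub continuousOn_const).mul (hg.sub continuousOn_const))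

lemma wnorm_eq {f : ℝ → ℝ} (hf : ContinuousOn f (Set.Icc 0 1)) :
    wnorm w.toFun f = cnorm (f ∘ w.invFun) := by
  rw [wnorm, w.winner_eq hf hf, cnorm]

end Warp

lemma sum_csim_eq {ι : Type*} {I : Finset ι} {φ : ι → ℝ → ℝ} {F : ℝ → ℝ}
    (hφ : ∀ j ∈ I, ContinuousOn (φ j) (Set.Icc 0 1)) (hF : ContinuousOn F (Set.Icc 0 1)) :
    ∑ j ∈ I, csim F (φ j) =
      cinner (fun t => ∑ j ∈ I, (cnorm (φ j))⁻¹ * φ j t) F / cnorm F := by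
  rw [cinner_sum_left hφ hF, Finset.sum_div]
  refine Finset.sum_congr rfl fun j _ => ?_
  rw [csim, cinner_comm F, div_eq_mul_inv, div_eq_mul_inv, mul_inv]
  ring

/-- Moving from a unit vector `p` towards `q` increases the cosine of the angle with `s`, as soon
as the step is small enough. -/
lemma cinner_le_cinner_lincomb_div_cnorm {p q s : ℝ → ℝ} (hp : ContinuousOn p (Set.Icc 0 1))
    (hq : ContinuousOn q (Set.Icc 0 1)) (hs : ContinuousOn s (Set.Icc 0 1))
    (hp1 : cnorm p = 1) (hsp : 0 ≤ cinner s p) (hqp : 0 ≤ cinner q p)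
    {lam : ℝ} (hlam : 0 < lam)
    (hpos : 0 < cinner q (fun t => s t - cinner s p * p t))
    (hle : ((cnorm (fun t => q t - cinner q p * p t)) ^ 2 * (cinner s p) ^ 2 -
        (cinner q (fun t => s t - cinner s p * p t)) ^ 2) /
        (2 * cinner s p * cinner q (fun t => s t - cinner s p * p t)) - cinner q p ≤ lam) :
    cinner s p ≤ cinner s (fun t => lam * p t + 1 * q t) /
      cnorm (fun t => lam * p t + 1 * q t) := by
  have hpp : cinner p p = 1 := by rw [← cnorm_sq, hp1, one_pow]
  have hP : cinner q (fun t => s t - cinner s p * p t) =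
      cinner s q - cinner s p * cinner q p := by
    have h := cinner_lincomb_right hs hp hq 1 (-cinner s p)
    rw [cinner_comm s q]
    convert h using 2
    · ext t; ring
    · ring
  have hQ : cnorm (fun t => q t - cinner q p * p t) ^ 2 = cinner q q - cinner q p ^ 2 := by
    have h := cinner_lincomb_self hq hp 1 (-cinner q p)
    rw [hpp] at h
    have hfun : (fun t => q t - cinner q p * p t) = fun t => 1 * q t + -cinner q p * p t := by
      ext t; ring
    rw [cnorm_sq, hfun, h]
    ring
  have hQ0 : 0 ≤ cinner q q - cinner q p ^ 2 := hQ ▸ sq_nonneg _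
  have hF := cinner_lincomb_self hp hq lam 1
  rw [hpp, cinner_comm p q, ← cnorm_sq] at hF
  rw [cinner_lincomb_right hp hq hs]
  rw [hP] at hpos hle
  rw [hQ] at hle
  set y := cnorm (fun t => lam * p t + 1 * q t) with hy
  have hy0 : 0 ≤ y := cnorm_nonneg _
  generalize cinner s p = S at *
  generalize cinner q p = G at *
  generalize cinner s q = T at *
  generalize cinner q q = K at *
  have hyp : 0 < y := by
    refine lt_of_le_of_ne hy0 fun h0 => ?_
    rw [← h0] at hF
    nlinarith [mul_pos hlam hlam, mul_nonneg hlam.le hqp]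
  rw [le_div_iff₀ hyp]
  have hnum : 0 ≤ lam * S + 1 * T := by nlinarith [mul_nonneg hlam.le hsp, mul_nonneg hsp hqp]
  refine abs_le_of_sq_le_sq' ?_ hnum |>.2
  rcases hsp.eq_or_lt with h0 | hS
  · rw [← h0, zero_mul, zero_pow two_ne_zero]
    exact sq_nonneg _
  · have h := sub_le_iff_le_add.mp hle
    rw [div_le_iff₀ (by positivity)] at h
    rw [mul_pow, hF]
    nlinarith

/-- A second order lower bound for `(A + b) / √(1 + d + e²)`. -/
lemma second_order_le_div {A b d e y : ℝ} (hb : |b| ≤ 1) (he0 : 0 ≤ e) (he1 : e ≤ 1)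
    (hd : |d| ≤ 2 * e) (hy0 : 0 ≤ y) (hy : y ^ 2 = 1 + d + e ^ 2) (hAb : |A + b| ≤ y) :
    A + (b - 1 / 2 * A * d) - (1 / 2 * (A * e ^ 2 + b * d + |b| * e) +
      3 / Real.sqrt 2 * (|A| + 1) * (|d| + e) ^ 2) ≤ (A + b) / y := by
  have hc : 2 ≤ 3 / Real.sqrt 2 := by
    rw [le_div_iff₀ (by positivity)]
    nlinarith [Real.sq_sqrt (show (0:ℝ) ≤ 2 by norm_num), Real.sqrt_nonneg 2]
  have hK : 2 * (|A| + 1) * (|d| + e) ^ 2 ≤ 3 / Real.sqrt 2 * (|A| + 1) * (|d| + e) ^ 2 := by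
    gcongr
  have hbe : b * e ^ 2 ≤ |b| * e := by
    calc b * e ^ 2 ≤ |b| * e ^ 2 := by gcongr; exact le_abs_self b
      _ ≤ |b| * e := by gcongr; nlinarith
  suffices h : (A + b) * (1 - (y ^ 2 - 1) / 2) - 2 * (|A| + 1) * (|d| + e) ^ 2 ≤ (A + b) / y by
    rw [hy] at h
    nlinarith
  have hN : |A + b| ≤ |A| + 1 := (abs_add_le A b).trans (by linarith)
  have hA0 := abs_nonneg A
  have hd0 := abs_nonneg d
  rcases lt_or_ge (y ^ 2) (1 / 2) with hsmall | hlarge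
  · have hdn : d < -(1 / 2) - e ^ 2 := by linarith
    have hde : -d ≤ |d| := neg_le_abs d
    have hlow : 3 / 4 ≤ |d| + e := by nlinarith
    have hsq : 9 / 16 ≤ (|d| + e) ^ 2 := by nlinarith
    have hratio : -1 ≤ (A + b) / y := by
      rcases hy0.eq_or_lt with h0 | hyp
      · rw [← h0]; simp
      · rw [le_div_iff₀ hyp]; linarith [(abs_le.mp hAb).1]
    have h1 : (|A| + 1) * (9 / 16) ≤ (|A| + 1) * (|d| + e) ^ 2 := by gcongr
    rcases le_total 0 (A + b) with hs | hs
    · have hyp : 0 ≤ (A + b) / y := div_nonneg hs hy0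
      have h2 := (le_abs_self (A + b)).trans hAb
      have h3 : y ≤ 3 / 4 := by nlinarith
      nlinarith [mul_nonneg hs (sq_nonneg y)]
    · nlinarith
  · have hyh : 1 / 2 ≤ y := by nlinarith
    have hyp : 0 < y := by linarith
    rw [le_div_iff₀ hyp]
    have hu : (y ^ 2 - 1) ^ 2 ≤ (|d| + e) ^ 2 := by
      refine sq_le_sq' ?_ ?_
      · rw [hy]; nlinarith [neg_abs_le d]
      · rw [hy]; nlinarith [le_abs_self d]
    have hR0 : 0 ≤ (y - 1) ^ 2 * (y + 2) := by positivity
    have hR : (y - 1) ^ 2 * (y + 2) ≤ 4 * y * (y ^ 2 - 1) ^ 2 := by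
      have h1 : y + 2 ≤ 4 * y * (y + 1) ^ 2 := by nlinarith [mul_nonneg hy0 (sq_nonneg y)]
      calc (y - 1) ^ 2 * (y + 2) ≤ (y - 1) ^ 2 * (4 * y * (y + 1) ^ 2) := by gcongr
        _ = 4 * y * (y ^ 2 - 1) ^ 2 := by ring
    have hmain : -(A + b) * ((y - 1) ^ 2 * (y + 2)) ≤
        (|A| + 1) * (4 * y * (|d| + e) ^ 2) := by
      calc -(A + b) * ((y - 1) ^ 2 * (y + 2))
          ≤ |A + b| * ((y - 1) ^ 2 * (y + 2)) := by gcongr; exact neg_le_abs _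
        _ ≤ (|A| + 1) * (4 * y * (y ^ 2 - 1) ^ 2) := by gcongr
        _ ≤ (|A| + 1) * (4 * y * (|d| + e) ^ 2) := by gcongr
    linarith

/-- A second order lower bound, in powers of `lam⁻¹`, for the similarity of `r` with
`lam • p + q`. -/
lemma second_order_le_csim {p q r : ℝ → ℝ} (hp : ContinuousOn p (Set.Icc 0 1))
    (hq : ContinuousOn q (Set.Icc 0 1)) (hr : ContinuousOn r (Set.Icc 0 1))
    (hr1 : cnorm r = 1) (hp0 : 0 < cnorm p) {lam A B D E : ℝ} (hlam : 0 < lam)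
    (hA : A = cinner p r / cnorm p) (hB : B = cinner q r / cnorm p)
    (hD : D = 2 * cinner p q / cnorm p ^ 2) (hE : E = cnorm q / cnorm p)
    (hEl : E ≤ lam) (hBl : |B| ≤ lam) :
    A + (B - 1 / 2 * A * D) / lam - (1 / 2 * (A * E ^ 2 + B * D + |B| * E) +
      3 / Real.sqrt 2 * (|A| + 1) * (|D| + E) ^ 2) / lam ^ 2 ≤
      csim r (fun t => lam * p t + 1 * q t) := by
  have hnorm := cinner_lincomb_self hp hq lam 1
  rw [← cnorm_sq, ← cnorm_sq p, ← cnorm_sq q] at hnorm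
  have hcs := abs_cinner_le (continuousOn_lincomb hp hq lam 1) hr
  have hpq := abs_cinner_le hp hq
  rw [csim, cinner_comm r, hr1]
  rw [hr1] at hcs
  rw [cinner_lincomb_left hp hq hr] at hcs ⊢
  have hq0 := cnorm_nonneg q
  have hy0 := cnorm_nonneg fun t => lam * p t + 1 * q t
  generalize cnorm (fun t => lam * p t + 1 * q t) = y at *
  generalize cnorm p = n at *
  generalize cnorm q = m at *
  generalize cinner p r = a at *
  generalize cinner q r = b at *
  generalize cinner p q = c at *
  have hE0 : 0 ≤ E := hE ▸ div_nonneg hq0 hp0.le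
  have hnum : A + B / lam = (lam * a + 1 * b) / (lam * n) := by
    rw [hA, hB]; field_simp
  have key := second_order_le_div (A := A) (b := B / lam) (d := D / lam) (e := E / lam)
    (y := y / (lam * n))
    (by rwa [abs_div, abs_of_pos hlam, div_le_one hlam]) (div_nonneg hE0 hlam.le)
    ((div_le_one hlam).mpr hEl)
    (by
      rw [abs_div, abs_of_pos hlam, ← mul_div_assoc]
      gcongr
      rw [hD, hE, abs_div, abs_of_pos (pow_pos hp0 2), abs_mul, abs_two,
        div_le_iff₀ (by positivity)]
      field_simp
      linarith)
    (by positivity)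
    (by rw [div_pow, hnorm, hD, hE]; field_simp)
    (by
      rw [hnum, abs_div, abs_of_pos (mul_pos hlam hp0)]
      gcongr
      linarith)
  rw [hnum, div_div_div_cancel_right₀ (by positivity)] at key
  rw [one_mul y]
  refine le_of_eq_of_le ?_ key
  rw [abs_div B, abs_div D, abs_of_pos hlam]
  field_simp

/-- under (C1)–(C6), `λ > 0`, `‖fⱼ∘ψⱼ‖ > 0` and `‖f₁‖ⱼ > 0` for
`2 ≤ j ≤ k`, for every `λ₀ ≥ 0` one has `Σⱼ ρ(f₁*, fⱼ | ψⱼ) ≥ Σⱼ ρ(f₁, fⱼ | ψⱼ)`. -/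
theorem stmt_3
    (k : ℕ) (hk : 2 ≤ k) (f : ℕ → ℝ → ℝ)
    (hf : ∀ j ∈ Finset.Icc 1 k, ContinuousOn (f j) (Set.Icc (0:ℝ) 1))
    (w : ℕ → Warp)
    (θ : ℕ → ℝ) (hθ : ∀ j ∈ Finset.Icc 2 k, θ j ∈ Set.Icc (0:ℝ) 1)
    (hθsum : ∑ j ∈ Finset.Icc 2 k, θ j = 1)
    (lam : ℝ) (hlam : 0 < lam)
    (g₀ : ℝ → ℝ)
    (hg₀ : g₀ = fun t => ∑ j ∈ Finset.Icc 2 k,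
      θ j * (f j ((w j).toFun t) / cnorm (f j ∘ (w j).toFun)))
    (fstar : ℝ → ℝ)
    (hfstar : fstar = fun t => (lam / (lam + 1)) * f 1 t + (1 / (lam + 1)) * g₀ t)
    (s : ℝ → ℝ)
    (hs : s = fun t => ∑ j ∈ Finset.Icc 2 k,
      f j ((w j).toFun t) / cnorm (f j ∘ (w j).toFun))
    (s₀ : ℝ → ℝ)
    (hs₀ : s₀ = fun t => ∑ j ∈ Finset.Icc 2 k,
      (f j ((w j).toFun t) - cinner (f j ∘ (w j).toFun) (f 1) * f 1 t) /
        cnorm (f j ∘ (w j).toFun))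
    (A B D E α β : ℕ → ℝ)
    (hA : ∀ j ∈ Finset.Icc 2 k, A j =
      winner (w j).toFun (f 1) (f j ∘ (w j).toFun) / wnorm (w j).toFun (f 1))
    (hB : ∀ j ∈ Finset.Icc 2 k, B j =
      winner (w j).toFun g₀ (f j ∘ (w j).toFun) / wnorm (w j).toFun (f 1))
    (hD : ∀ j ∈ Finset.Icc 2 k, D j =
      2 * winner (w j).toFun (f 1) g₀ / (wnorm (w j).toFun (f 1)) ^ 2)
    (hE : ∀ j ∈ Finset.Icc 2 k, E j =
      wnorm (w j).toFun g₀ / wnorm (w j).toFun (f 1))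
    (hα : ∀ j ∈ Finset.Icc 2 k, α j = B j - (1 / 2) * A j * D j)
    (hβ : ∀ j ∈ Finset.Icc 2 k, β j =
      (1 / 2) * (A j * E j ^ 2 + B j * D j + |B j| * E j) +
        (3 / Real.sqrt 2) * (|A j| + 1) * (|D j| + E j) ^ 2)
    (LC5 : ℝ)
    (hLC5 : LC5 = ((cnorm (fun t => g₀ t - cinner g₀ (f 1) * f 1 t)) ^ 2 *
        (cinner s (f 1)) ^ 2 - (cinner g₀ s₀) ^ 2) /
        (2 * cinner s (f 1) * cinner g₀ s₀) - cinner g₀ (f 1))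
    (LC6 : ℝ)
    (hLC6 : LC6 = max ((∑ j ∈ Finset.Icc 2 k, β j) / (∑ j ∈ Finset.Icc 2 k, α j))
      ((Finset.Icc 2 k).sup' (Finset.nonempty_Icc.mpr hk) fun j => max (E j) |B j|))
    (hC1 : ∀ j ∈ Finset.Icc 1 k, cnorm (f j) = 1)
    (hC2 : ∀ j ∈ Finset.Icc 2 k, 0 ≤ cinner (f 1) (f j ∘ (w j).toFun))
    (hC3 : 0 < cinner g₀ s₀)
    (hC4 : 0 < ∑ l ∈ Finset.Icc 2 k, winner (w l).toFun g₀
      (fun t => (1 / wnorm (w l).toFun (f 1)) *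
        (f l ((w l).toFun t) -
          winner (w l).toFun (f l ∘ (w l).toFun) (f 1) * f 1 t /
            (wnorm (w l).toFun (f 1)) ^ 2)))
    (hC5 : lam ≥ LC5)
    (hC6 : lam ≥ LC6)
    (hpos : ∀ j ∈ Finset.Icc 2 k, 0 < cnorm (f j ∘ (w j).toFun))
    (hpos1 : ∀ j ∈ Finset.Icc 2 k, 0 < wnorm (w j).toFun (f 1))
    : ∀ l₀ : ℝ, 0 ≤ l₀ →
      ∑ j ∈ Finset.Icc 2 k, rhoW l₀ fstar (f j) (w j) ≥
        ∑ j ∈ Finset.Icc 2 k, rhoW l₀ (f 1) (f j) (w j) := by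
  intro l₀ _
  have h1k : 1 ∈ Finset.Icc 1 k := Finset.mem_Icc.mpr ⟨le_rfl, by omega⟩
  have hmem : ∀ j ∈ Finset.Icc 2 k, j ∈ Finset.Icc 1 k := fun j hj => by
    rw [Finset.mem_Icc] at hj ⊢; omega
  have hf1 := hf 1 h1k
  have hφ : ∀ j ∈ Finset.Icc 2 k, ContinuousOn (f j ∘ (w j).toFun) (Set.Icc 0 1) :=
    fun j hj => (w j).continuousOn_comp (hf j (hmem j hj))
  have hg₀' : g₀ = fun t => ∑ j ∈ Finset.Icc 2 k,
      (θ j * (cnorm (f j ∘ (w j).toFun))⁻¹) * (f j ∘ (w j).toFun) t := by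
    rw [hg₀]
    ext t
    refine Finset.sum_congr rfl fun j _ => ?_
    rw [Function.comp_apply, div_eq_mul_inv]
    ring
  have hs' : s = fun t => ∑ j ∈ Finset.Icc 2 k,
      (cnorm (f j ∘ (w j).toFun))⁻¹ * (f j ∘ (w j).toFun) t := by
    rw [hs]
    ext t
    refine Finset.sum_congr rfl fun j _ => ?_
    rw [Function.comp_apply, div_eq_mul_inv, mul_comm]
  have hg₀c : ContinuousOn g₀ (Set.Icc 0 1) := hg₀' ▸ continuousOn_sum_mul hφ _
  have hsc : ContinuousOn s (Set.Icc 0 1) := hs' ▸ continuousOn_sum_mul hφ _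
  have hFc := continuousOn_lincomb hf1 hg₀c lam 1
  have hfstar' : fstar = fun t => 1 / (lam + 1) * (lam * f 1 t + 1 * g₀ t) := by
    rw [hfstar]
    ext t
    ring
  have hl1 : 0 < 1 / (lam + 1) := by positivity
  have hS : cinner s (f 1) = ∑ j ∈ Finset.Icc 2 k,
      (cnorm (f j ∘ (w j).toFun))⁻¹ * cinner (f j ∘ (w j).toFun) (f 1) := by
    rw [hs', cinner_sum_left hφ hf1]
  have hS0 : 0 ≤ cinner s (f 1) := by
    rw [hS]
    refine Finset.sum_nonneg fun j hj => mul_nonneg (inv_nonneg.mpr (cnorm_nonneg _)) ?_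
    rw [cinner_comm]
    exact hC2 j hj
  have hG0 : 0 ≤ cinner g₀ (f 1) := by
    rw [hg₀', cinner_sum_left hφ hf1]
    refine Finset.sum_nonneg fun j hj =>
      mul_nonneg (mul_nonneg (hθ j hj).1 (inv_nonneg.mpr (cnorm_nonneg _))) ?_
    rw [cinner_comm]
    exact hC2 j hj
  have hs₀' : s₀ = fun t => s t - cinner s (f 1) * f 1 t := by
    rw [hs₀, hS, hs']
    ext t
    rw [Finset.sum_mul, ← Finset.sum_sub_distrib]
    refine Finset.sum_congr rfl fun j _ => ?_
    rw [Function.comp_apply, div_eq_mul_inv]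
    ring
  have forward : ∑ j ∈ Finset.Icc 2 k, csim (f 1) (f j ∘ (w j).toFun) ≤
      ∑ j ∈ Finset.Icc 2 k, csim fstar (f j ∘ (w j).toFun) := by
    have hscale : ∀ h, csim fstar h = csim (fun t => lam * f 1 t + 1 * g₀ t) h := fun h => by
      rw [csim_comm, hfstar', csim_const_mul_right h hl1, csim_comm]
    simp only [hscale]
    rw [sum_csim_eq hφ hf1, sum_csim_eq hφ hFc, ← hs', hC1 1 h1k, div_one]
    rw [hs₀'] at hC3 hLC5
    exact cinner_le_cinner_lincomb_div_cnorm hf1 hg₀c hsc (hC1 1 h1k) hS0 hG0 hlam hC3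
      (hLC5 ▸ hC5)
  have hαsum : 0 < ∑ j ∈ Finset.Icc 2 k, α j := by
    refine hC4.trans_eq (Finset.sum_congr rfl fun j hj => ?_)
    have hjc := hφ j hj
    have hn := hpos1 j hj
    have hfun : (fun t => (1 / wnorm (w j).toFun (f 1)) * (f j ((w j).toFun t) -
          winner (w j).toFun (f j ∘ (w j).toFun) (f 1) * f 1 t /
            (wnorm (w j).toFun (f 1)) ^ 2)) =
        fun t => (1 / wnorm (w j).toFun (f 1)) * (f j ∘ (w j).toFun) t +
          (-(winner (w j).toFun (f j ∘ (w j).toFun) (f 1) /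
            (wnorm (w j).toFun (f 1)) ^ 3)) * f 1 t := by
      ext t
      rw [Function.comp_apply]
      field_simp
      ring
    rw [hfun, (w j).winner_eq hg₀c (continuousOn_lincomb hjc hf1 _ _)]
    refine (cinner_lincomb_right ((w j).continuousOn_comp_inv hjc)
      ((w j).continuousOn_comp_inv hf1) ((w j).continuousOn_comp_inv hg₀c) _ _).trans ?_
    rw [hα j hj, hA j hj, hB j hj, hD j hj, (w j).winner_eq hf1 hjc, (w j).winner_eq hjc hf1,
      (w j).winner_eq hg₀c hjc, (w j).winner_eq hf1 hg₀c,
      cinner_comm (g₀ ∘ (w j).invFun) (f 1 ∘ (w j).invFun),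
      cinner_comm ((f j ∘ (w j).toFun) ∘ (w j).invFun) (f 1 ∘ (w j).invFun)]
    field_simp
    ring
  have hβα : (∑ j ∈ Finset.Icc 2 k, β j) ≤ lam * ∑ j ∈ Finset.Icc 2 k, α j := by
    rw [← div_le_iff₀ hαsum]
    exact (le_max_left _ _).trans (hLC6 ▸ hC6)
  have hEB : ∀ j ∈ Finset.Icc 2 k, max (E j) |B j| ≤ lam := fun j hj =>
    (Finset.le_sup' (fun j => max (E j) |B j|) hj).trans
      ((le_max_right _ _).trans (hLC6 ▸ hC6))
  have backward : ∑ j ∈ Finset.Icc 2 k, csim (f j) (f 1 ∘ (w j).invFun) ≤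
      ∑ j ∈ Finset.Icc 2 k, csim (f j) (fstar ∘ (w j).invFun) := by
    calc ∑ j ∈ Finset.Icc 2 k, csim (f j) (f 1 ∘ (w j).invFun)
        = ∑ j ∈ Finset.Icc 2 k, A j := Finset.sum_congr rfl fun j hj => by
          rw [hA j hj, (w j).winner_eq hf1 (hφ j hj), (w j).wnorm_eq hf1,
            cinner_congr (Set.eqOn_refl _ _) ((w j).eqOn_comp_comp_inv (f j)), csim,
            hC1 j (hmem j hj), one_mul, cinner_comm]
      _ ≤ ∑ j ∈ Finset.Icc 2 k, (A j + α j / lam - β j / lam ^ 2) := by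
          rw [Finset.sum_sub_distrib, Finset.sum_add_distrib, ← Finset.sum_div,
            ← Finset.sum_div, add_sub_assoc, le_add_iff_nonneg_right, sub_nonneg,
            div_le_div_iff₀ (by positivity) hlam]
          nlinarith
      _ ≤ ∑ j ∈ Finset.Icc 2 k, csim (f j) (fstar ∘ (w j).invFun) := by
          refine Finset.sum_le_sum fun j hj => ?_
          have hE' := hE j hj
          have hD' := hD j hj
          have hA' := hA j hj
          have hB' := hB j hj
          have hn := hpos1 j hj
          rw [(w j).wnorm_eq hf1] at hA' hB' hD' hE' hn
          rw [(w j).wnorm_eq hg₀c] at hE'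
          rw [(w j).winner_eq hf1 hg₀c] at hD'
          rw [(w j).winner_eq hf1 (hφ j hj),
            cinner_congr (Set.eqOn_refl _ _) ((w j).eqOn_comp_comp_inv (f j))] at hA'
          rw [(w j).winner_eq hg₀c (hφ j hj),
            cinner_congr (Set.eqOn_refl _ _) ((w j).eqOn_comp_comp_inv (f j))] at hB'
          have key := second_order_le_csim ((w j).continuousOn_comp_inv hf1)
            ((w j).continuousOn_comp_inv hg₀c) (hf j (hmem j hj)) (hC1 j (hmem j hj)) hn hlam
            hA' hB' hD' hE' ((le_max_left _ _).trans (hEB j hj))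
            ((le_max_right _ _).trans (hEB j hj))
          rw [← csim_const_mul_right _ hl1] at key
          rw [hα j hj, hβ j hj, hfstar']
          exact key
  simp only [rhoW, rhoStar, ← Finset.sum_div, Finset.sum_add_distrib, Finset.sum_sub_distrib]
  linarith

end
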